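/- Let 𝐝 = (d_1,…,d_s) with 1 ≤ d_1 < … < d_s < n, and let 𝐦, 𝐦' ∈ ℤ_{≥0}^{n−1} satisfy m_i = 0 and m'_i = 0 unless i ∈ {d_1,…,d_s}. Then for any M, M' ∈ ℤ_{≥0} the Minkowski sum of the sets of integer points satisfies S_{𝐝,𝐦,M} + S_{𝐝,𝐦',M'} = S_{𝐝,𝐦+𝐦',M+M'}. -/

import Mathlib

open scoped Pointwise

/-- The poset `P` of pairs `(i,j)` with `1 ≤ j < i ≤ n` (componentwise order). -/
def posetP (n : ℕ) : Finset (ℕ × ℕ) :=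
  (Finset.range (n + 1) ×ˢ Finset.range (n + 1)).filter
    (fun p => 1 ≤ p.2 ∧ p.2 < p.1 ∧ p.1 ≤ n)

/-- The subposet `P_d = {(i,j) ∈ P : i > d ≥ j}`. -/
def posetPd (n d : ℕ) : Finset (ℕ × ℕ) :=
  (posetP n).filter (fun p => d < p.1 ∧ p.2 ≤ d)

/-- `P_𝐝 = P_{d_1} ∪ … ∪ P_{d_s}` for `𝐝` given as a finite set `D ⊆ {1,…,n-1}`. -/
def posetPD (n : ℕ) (D : Finset ℕ) : Finset (ℕ × ℕ) :=
  D.biUnion (posetPd n)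

/-- The width of a finite subset of `ℕ × ℕ` (with the componentwise order):
the maximal cardinality of an antichain contained in it. -/
noncomputable def finWidth (Q : Finset (ℕ × ℕ)) : ℕ :=
  sSup (Finset.card '' {A : Finset (ℕ × ℕ) |
    A ⊆ Q ∧ IsAntichain (· ≤ ·) (A : Set (ℕ × ℕ))})

/-- The polytope `X_{𝐝,𝐦,M} ⊆ ℝ_{≥0}^{P_𝐝}`, realized as the set of functions
`ℕ × ℕ → ℝ` supported on `P_𝐝`, with nonnegative coordinates, satisfying for every
`P' ⊆ P_𝐝` the inequality `Σ_{α ∈ P'} x_α ≤ M + Σ_{a=1}^{s} m_{d_a} · w(P' ∩ P_{d_a})`. -/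
def polytopeXD (n : ℕ) (D : Finset ℕ) (m : ℕ → ℕ) (M : ℕ) : Set (ℕ × ℕ → ℝ) :=
  {x | (∀ α, α ∉ posetPD n D → x α = 0) ∧ (∀ α, 0 ≤ x α) ∧
    ∀ P' ⊆ posetPD n D,
      ∑ α ∈ P', x α ≤
        (M : ℝ) + ∑ d ∈ D, (m d : ℝ) * (finWidth (P' ∩ posetPd n d) : ℝ)}

/-- `S_{𝐝,𝐦,M} = X_{𝐝,𝐦,M} ∩ ℤ^{P_𝐝}`: the set of integer points. -/
def latticeSD (n : ℕ) (D : Finset ℕ) (m : ℕ → ℕ) (M : ℕ) : Set (ℕ × ℕ → ℤ) :=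
  {x | (fun α => (x α : ℝ)) ∈ polytopeXD n D m M}

section Assignment

variable {ι : Type*} [Fintype ι] [DecidableEq ι]

/-- Egerváry's theorem: strong integer duality for the assignment problem. -/
theorem exists_perm_dual_eq (c : ι → ι → ℤ) :
    ∃ (σ : Equiv.Perm ι) (u v : ι → ℤ), (∀ a b, u a + v b ≤ c a b) ∧
      ∑ a, (u a + v a) = ∑ a, c a (σ a) := by
  classical
  let T : Set ℤ := {k | ∃ u v : ι → ℤ, (∀ a b, u a + v b ≤ c a b) ∧ ∑ a, (u a + v a) = k}
  have hne : ∃ k, k ∈ T := by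
    refine ⟨_, fun _ => -∑ a, ∑ b, |c a b|, fun _ => 0, fun a b => ?_, rfl⟩
    have h1 : |c a b| ≤ ∑ b, |c a b| :=
      Finset.single_le_sum (f := fun b => |c a b|) (fun _ _ => abs_nonneg _) (Finset.mem_univ b)
    have h2 : ∑ b, |c a b| ≤ ∑ a, ∑ b, |c a b| :=
      Finset.single_le_sum (f := fun a => ∑ b, |c a b|)
        (fun _ _ => Finset.sum_nonneg fun _ _ => abs_nonneg _) (Finset.mem_univ a)
    have h3 := neg_abs_le (c a b)
    linarith
  have hbdd : ∀ k, k ∈ T → k ≤ ∑ a, c a a := by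
    rintro k ⟨u, v, h, rfl⟩
    exact Finset.sum_le_sum fun a _ => h a a
  obtain ⟨_, ⟨u, v, huv, rfl⟩, hmax⟩ := Int.exists_greatest_of_bdd ⟨_, hbdd⟩ hne
  let N : ι → Finset ι := fun a => Finset.univ.filter fun b => u a + v b = c a b
  have hall : ∀ S : Finset ι, S.card ≤ (S.biUnion N).card := by
    intro S
    have key := hmax (∑ a, ((u a + if a ∈ S then 1 else 0) +
        (v a - if a ∈ S.biUnion N then 1 else 0)))
      ⟨fun a => u a + if a ∈ S then 1 else 0,
        fun b => v b - if b ∈ S.biUnion N then 1 else 0, fun a b => ?_, rfl⟩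
    · have : ∑ a, ((u a + if a ∈ S then 1 else 0) + (v a - if a ∈ S.biUnion N then 1 else 0))
          = ∑ a, (u a + v a) + (S.card - (S.biUnion N).card : ℤ) := by
        have hcard : ∀ R : Finset ι, (R.card : ℤ) = ∑ a, if a ∈ R then 1 else 0 := by simp
        rw [hcard, hcard, ← Finset.sum_sub_distrib, ← Finset.sum_add_distrib]
        exact Finset.sum_congr rfl fun a _ => by ring
      rw [this] at key
      have : (S.card : ℤ) ≤ (S.biUnion N).card := by linarith
      exact_mod_cast this
    · have hab := huv a b
      by_cases hb : b ∈ S.biUnion N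
      · simp only [if_pos hb]
        split_ifs <;> linarith
      · simp only [if_neg hb]
        split_ifs with ha
        · have hlt : u a + v b ≠ c a b := fun h =>
            hb (Finset.mem_biUnion.2 ⟨a, ha, Finset.mem_filter.2 ⟨Finset.mem_univ _, h⟩⟩)
          omega
        · linarith
  obtain ⟨f, hf, hfN⟩ := (Finset.all_card_le_biUnion_card_iff_exists_injective N).1 hall
  let σ : Equiv.Perm ι := Equiv.ofBijective f (Finite.injective_iff_bijective.1 hf)
  refine ⟨σ, u, v, huv, ?_⟩
  have h : ∀ a, c a (σ a) = u a + v (σ a) := fun a => ((Finset.mem_filter.1 (hfN a)).2).symm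
  simp only [h, Finset.sum_add_distrib]
  rw [Equiv.sum_comp σ v]

end Assignment

section Potentials

variable {ι : Type*} [Fintype ι] [DecidableEq ι] [PartialOrder ι]

/-- If a permutation links its points into chains, except for fixed points in `Z` and chain ends
in `E`, then an antichain outside `Z` in the band `j ≤ d < i` is no larger than the number of
chains crossing the band. -/
theorem card_antichain_add_card_starts_le {i j : ι → ℕ} (hi : Monotone i) (hj : Monotone j)
    (hij : ∀ a, j a < i a) (σ : Equiv.Perm ι) (Z E : Finset ι)
    (hZ : ∀ a ∈ Z, σ a = a) (hE : ∀ a ∈ E, a ∉ Z) (hlink : ∀ a, a ∉ Z → a ∉ E → a < σ a)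
    (d : ℕ) (A : Finset ι) (hAZ : ∀ a ∈ A, a ∉ Z) (hA : IsAntichain (· ≤ ·) (A : Set ι))
    (hAd : ∀ a ∈ A, j a ≤ d ∧ d < i a) :
    A.card + (E.filter fun a => d < j (σ a)).card ≤ (E.filter fun a => d < i a).card := by
  classical
  have hσZ : ∀ a, a ∉ Z → σ a ∉ Z := fun a ha h => ha (σ.injective (hZ _ h) ▸ h)
  let V : Finset ι := Finset.univ.filter fun a => a ∉ Z ∧ (d < j a ∨ ∃ b ∈ A, b < a)
  have hV : ∀ a, a ∈ V ↔ a ∉ Z ∧ (d < j a ∨ ∃ b ∈ A, b < a) := by simp [V]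
  have hdisj : Disjoint A V := by
    rw [Finset.disjoint_left]
    intro a ha hav
    rcases ((hV a).1 hav).2 with h | ⟨b, hb, hba⟩
    · have := (hAd a ha).1
      omega
    · exact hA hb ha hba.ne hba.le
  have hmaps : ∀ a ∈ (A ∪ V) \ E, σ a ∈ V := by
    intro a ha
    obtain ⟨hav, haE⟩ := Finset.mem_sdiff.1 ha
    rcases Finset.mem_union.1 hav with h | h
    · have hlt := hlink a (hAZ a h) haE
      exact (hV _).2 ⟨hσZ a (hAZ a h), Or.inr ⟨a, h, hlt⟩⟩
    · obtain ⟨haZ, h⟩ := (hV a).1 h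
      have hlt := hlink a haZ haE
      refine (hV _).2 ⟨hσZ a haZ, h.imp (fun h => h.trans_le (hj hlt.le)) ?_⟩
      rintro ⟨b, hb, hba⟩
      exact ⟨b, hb, hba.trans hlt⟩
  have h1 : (((A ∪ V) \ E) ∪ (E.filter fun a => σ a ∈ V)).card ≤ V.card := by
    refine Finset.card_le_card_of_injOn σ ?_ σ.injective.injOn
    intro a ha
    rcases Finset.mem_union.1 ha with h | h
    · exact hmaps a h
    · exact (Finset.mem_filter.1 h).2
  rw [Finset.card_union_of_disjoint (Finset.sdiff_disjoint.mono_right (Finset.filter_subset _ _))]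
    at h1
  have h2 := Finset.card_sdiff_add_card_inter (A ∪ V) E
  rw [Finset.card_union_of_disjoint hdisj] at h2
  have h3 : ((A ∪ V) ∩ E).card ≤ (E.filter fun a => d < i a).card := by
    refine Finset.card_le_card fun a ha => ?_
    obtain ⟨hav, haE⟩ := Finset.mem_inter.1 ha
    refine Finset.mem_filter.2 ⟨haE, ?_⟩
    rcases Finset.mem_union.1 hav with h | h
    · exact (hAd a h).2
    · rcases ((hV a).1 h).2 with h | ⟨b, hb, hba⟩
      · exact h.trans (hij a)
      · exact (hAd b hb).2.trans_le (hi hba.le)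
  have h4 : (E.filter fun a => d < j (σ a)).card ≤ (E.filter fun a => σ a ∈ V).card := by
    refine Finset.card_le_card fun a ha => ?_
    obtain ⟨haE, h⟩ := Finset.mem_filter.1 ha
    exact Finset.mem_filter.2 ⟨haE, (hV _).2 ⟨hσZ a (hE a haE), Or.inl h⟩⟩
  omega

/-- The min-max theorem behind the decomposition: if the total of `x` over every set `Q` is at most
`M` plus a weighted count of antichains in `Q`, there are integer potentials `p`, `q` such that the
sets `{p < t ≤ q}` are antichains and `q - p ≤ x` accounts for all of `x` up to an excess of `M`. -/
theorem exists_potentials {i j : ι → ℕ} (hi : Monotone i) (hj : Monotone j)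
    (hij : ∀ a, j a < i a) (D : Finset ℕ) (m : ℕ → ℕ) (hm : ∀ d, d ∉ D → m d = 0) (M : ℕ)
    (x : ι → ℤ)
    (hx : ∀ Q : Finset ι, ∃ B : ℕ → Finset ι,
      (∀ d ∈ D, B d ⊆ Q ∧ IsAntichain (· ≤ ·) (B d : Set ι) ∧ ∀ a ∈ B d, j a ≤ d ∧ d < i a) ∧
      ∑ a ∈ Q, x a ≤ M + ∑ d ∈ D, (m d : ℤ) * (B d).card) :
    ∃ p q : ι → ℤ, (∀ a, q a - p a ≤ x a) ∧ (∀ a b, a < b → q a ≤ p b) ∧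
      (∀ a, q a ≤ ∑ d ∈ Finset.range (i a), (m d : ℤ)) ∧
      (∀ a, ∑ d ∈ Finset.range (j a), (m d : ℤ) ≤ p a) ∧
      ∑ a, x a ≤ M + ∑ a, (q a - p a) := by
  classical
  let s : ℕ → ℤ := fun k => ∑ d ∈ Finset.range k, (m d : ℤ)
  have hs : ∀ k, s k = ∑ d ∈ D, (m d : ℤ) * if d < k then 1 else 0 := by
    intro k
    simp only [s, mul_ite, mul_one, mul_zero]
    rw [← Finset.sum_filter]
    symm
    apply Finset.sum_subset
    · intro d hd
      simpa using (Finset.mem_filter.1 hd).2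
    · intro d hd hd'
      have : d ∉ D := fun h => hd' (Finset.mem_filter.2 ⟨h, Finset.mem_range.1 hd⟩)
      simp [hm d this]
  let c : ι → ι → ℤ := fun a b =>
    if a < b then min 0 (s (i a) - s (j b))
    else if a = b then min (x a) (s (i a) - s (j b)) else s (i a) - s (j b)
  have hc_le : ∀ a b, c a b ≤ s (i a) - s (j b) := by
    intro a b
    simp only [c]
    split_ifs <;> simp
  have hc_lt : ∀ a b, a < b → c a b ≤ 0 := fun a b h => by simp [c, h]
  have hc_self : ∀ a, c a a ≤ x a := fun a => by simp [c]
  obtain ⟨σ, u, v, huv, hsum⟩ := exists_perm_dual_eq c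
  let Z : Finset ι := Finset.univ.filter fun a => σ a = a ∧ c a (σ a) = x a
  let E : Finset ι := Finset.univ.filter fun a => a ∉ Z ∧ ¬ (a < σ a ∧ c a (σ a) = 0)
  have hZ : ∀ a, a ∈ Z ↔ σ a = a ∧ c a (σ a) = x a := by simp [Z]
  have hE : ∀ a, a ∈ E ↔ a ∉ Z ∧ ¬ (a < σ a ∧ c a (σ a) = 0) := fun a => by
    simp only [E, Finset.mem_filter, Finset.mem_univ, true_and]
  have hcE : ∀ a ∈ E, c a (σ a) = s (i a) - s (j (σ a)) := by
    intro a ha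
    obtain ⟨h1, h2⟩ := (hE a).1 ha
    rw [hZ] at h1
    by_cases h : a < σ a
    · have h3 : c a (σ a) = min 0 (s (i a) - s (j (σ a))) := by simp [c, h]
      rcases min_choice 0 (s (i a) - s (j (σ a))) with h4 | h4
      · exact absurd ⟨h, h3.trans h4⟩ h2
      · exact h3.trans h4
    · by_cases h' : a = σ a
      · have h3 : c a (σ a) = min (x a) (s (i a) - s (j (σ a))) := by
          simp only [c, if_neg h, if_pos h']
        rcases min_choice (x a) (s (i a) - s (j (σ a))) with h4 | h4
        · exact absurd ⟨h'.symm, h3.trans h4⟩ h1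
        · exact h3.trans h4
      · simp only [c, if_neg h, if_neg h']
  have hlink : ∀ a, a ∉ Z → a ∉ E → a < σ a ∧ c a (σ a) = 0 := by
    intro a h1 h2
    by_contra h
    exact h2 ((hE a).2 ⟨h1, h⟩)
  have hEZ : ∀ a ∈ E, a ∉ Z := fun a h => ((hE a).1 h).1
  have hcost : ∑ a, c a (σ a) = ∑ a ∈ Z, x a + ∑ a ∈ E, (s (i a) - s (j (σ a))) := by
    have hd : Disjoint Z E := Finset.disjoint_right.2 hEZ
    rw [← Finset.sum_congr rfl hcE, ← Finset.sum_congr rfl fun a ha => ((hZ a).1 ha).2,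
      ← Finset.sum_union hd]
    symm
    apply Finset.sum_subset (Finset.subset_univ _)
    intro a _ ha
    simp only [Finset.mem_union, not_or] at ha
    exact (hlink a ha.1 ha.2).2
  obtain ⟨B, hB, hxB⟩ := hx Zᶜ
  have hends : ∑ a ∈ E, (s (i a) - s (j (σ a))) = ∑ d ∈ D, (m d : ℤ) *
      ((E.filter fun a => d < i a).card - (E.filter fun a => d < j (σ a)).card) := by
    simp only [hs, Finset.card_filter, Nat.cast_sum, Nat.cast_ite, Nat.cast_one, Nat.cast_zero,
      mul_sub, Finset.mul_sum, Finset.sum_sub_distrib]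
    rw [Finset.sum_comm, Finset.sum_comm (s := E)]
  have hwidth : ∑ d ∈ D, (m d : ℤ) * (B d).card ≤ ∑ a ∈ E, (s (i a) - s (j (σ a))) := by
    rw [hends]
    refine Finset.sum_le_sum fun d hd => mul_le_mul_of_nonneg_left ?_ (Nat.cast_nonneg _)
    obtain ⟨h1, h2, h3⟩ := hB d hd
    have := card_antichain_add_card_starts_le hi hj hij σ Z E (fun a ha => ((hZ a).1 ha).1) hEZ
      (fun a h h' => (hlink a h h').1) d (B d) (fun a ha => Finset.mem_compl.1 (h1 ha)) h2 h3
    have : ((B d).card : ℤ) + (E.filter fun a => d < j (σ a)).card ≤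
        (E.filter fun a => d < i a).card := by exact_mod_cast this
    linarith
  have htotal : ∑ a, x a ≤ M + ∑ a, (u a + v a) := by
    rw [hsum, hcost, ← Finset.sum_add_sum_compl Z x]
    linarith
  obtain ⟨r, hru, hrv⟩ : ∃ r, (∀ a, u a - s (i a) ≤ r) ∧ ∀ b, r ≤ -v b - s (j b) := by
    rcases isEmpty_or_nonempty ι with h | h
    · exact ⟨0, fun a => h.elim a, fun a => h.elim a⟩
    · obtain ⟨a, ha⟩ := Finite.exists_max fun a => u a - s (i a)
      refine ⟨_, ha, fun b => ?_⟩
      have := (huv a b).trans (hc_le a b)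
      linarith
  refine ⟨fun a => -v a - r, fun a => u a - r, fun a => ?_, fun a b hab => ?_, fun a => ?_,
    fun a => ?_, ?_⟩
  · have := (huv a a).trans (hc_self a)
    linarith
  · have := (huv a b).trans (hc_lt a b hab)
    linarith
  · have := hru a
    simp only [s] at this
    linarith
  · have := hrv a
    simp only [s] at this
    linarith
  · refine htotal.trans_eq ?_
    congr 1
    exact Finset.sum_congr rfl fun a _ => by ring

end Potentials

section Width

theorem bddAbove_card_antichains (Q : Finset (ℕ × ℕ)) :
    BddAbove (Finset.card '' {A : Finset (ℕ × ℕ) |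
      A ⊆ Q ∧ IsAntichain (· ≤ ·) (A : Set (ℕ × ℕ))}) := by
  refine ⟨Q.card, ?_⟩
  rintro _ ⟨A, ⟨hA, -⟩, rfl⟩
  exact Finset.card_le_card hA

theorem card_le_finWidth {A Q : Finset (ℕ × ℕ)} (hAQ : A ⊆ Q)
    (hA : IsAntichain (· ≤ ·) (A : Set (ℕ × ℕ))) : A.card ≤ finWidth Q :=
  le_csSup (bddAbove_card_antichains Q) ⟨A, ⟨hAQ, hA⟩, rfl⟩

theorem exists_antichain_card_eq_finWidth (Q : Finset (ℕ × ℕ)) :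
    ∃ A ⊆ Q, IsAntichain (· ≤ ·) (A : Set (ℕ × ℕ)) ∧ A.card = finWidth Q := by
  obtain ⟨A, ⟨h1, h2⟩, h3⟩ := Nat.sSup_mem (s := Finset.card '' {A : Finset (ℕ × ℕ) |
      A ⊆ Q ∧ IsAntichain (· ≤ ·) (A : Set (ℕ × ℕ))}) ⟨_, ∅, by simp, rfl⟩
    (bddAbove_card_antichains Q)
  exact ⟨A, h1, h2, h3⟩

end Width

theorem mem_latticeSD_iff {n : ℕ} {D : Finset ℕ} {m : ℕ → ℕ} {M : ℕ} {x : ℕ × ℕ → ℤ} :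
    x ∈ latticeSD n D m M ↔ (∀ α, α ∉ posetPD n D → x α = 0) ∧ (∀ α, 0 ≤ x α) ∧
      ∀ P' ⊆ posetPD n D,
        ∑ α ∈ P', x α ≤ (M : ℤ) + ∑ d ∈ D, (m d : ℤ) * (finWidth (P' ∩ posetPd n d) : ℤ) := by
  simp only [latticeSD, polytopeXD, Set.mem_ofPred_eq]
  norm_cast

/-- A sum of `m d` antichains of `P_d` for each `d ∈ D` and at most `M` unit vectors lies in
`S_{D,m,M}`. -/
theorem mem_latticeSD_of_antichains {n : ℕ} {D : Finset ℕ} {m : ℕ → ℕ} {M : ℕ}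
    {A : ℕ → ℕ → Finset (ℕ × ℕ)} {z : ℕ × ℕ → ℤ}
    (hA : ∀ d ∈ D, ∀ k < m d, A d k ⊆ posetPd n d ∧ IsAntichain (· ≤ ·) (A d k : Set (ℕ × ℕ)))
    (hz : ∀ α, 0 ≤ z α) (hzD : ∀ α, α ∉ posetPD n D → z α = 0)
    (hzM : ∑ α ∈ posetPD n D, z α ≤ M) :
    (fun α => ∑ d ∈ D, ∑ k ∈ Finset.range (m d), (if α ∈ A d k then 1 else 0) + z α) ∈
      latticeSD n D m M := by
  refine mem_latticeSD_iff.2 ⟨fun α hα => ?_, fun α => ?_, fun P' hP' => ?_⟩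
  · rw [hzD α hα, add_zero]
    refine Finset.sum_eq_zero fun d hd => Finset.sum_eq_zero fun k hk => if_neg fun h => hα ?_
    exact Finset.mem_biUnion.2 ⟨d, hd, (hA d hd k (Finset.mem_range.1 hk)).1 h⟩
  · refine add_nonneg (Finset.sum_nonneg fun d _ => Finset.sum_nonneg fun k _ => ?_) (hz α)
    split_ifs <;> simp
  · rw [Finset.sum_add_distrib, add_comm]
    refine add_le_add ((Finset.sum_le_sum_of_subset_of_nonneg hP' fun α _ _ => hz α).trans hzM) ?_
    rw [Finset.sum_comm]
    refine Finset.sum_le_sum fun d hd => ?_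
    rw [Finset.sum_comm]
    calc ∑ k ∈ Finset.range (m d), ∑ α ∈ P', (if α ∈ A d k then (1 : ℤ) else 0)
        ≤ ∑ k ∈ Finset.range (m d), (finWidth (P' ∩ posetPd n d) : ℤ) := by
          refine Finset.sum_le_sum fun k hk => ?_
          obtain ⟨h1, h2⟩ := hA d hd k (Finset.mem_range.1 hk)
          rw [Finset.sum_ite_mem, Finset.sum_const, nsmul_one]
          exact_mod_cast card_le_finWidth (Finset.inter_subset_inter_left h1)
            (h2.subset (by simp))
      _ = _ := by simp

theorem sum_range_sum_range_eq {R : Type*} [AddCommMonoid R] (m : ℕ → ℕ) (g : ℕ → R) (N : ℕ) :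
    ∑ d ∈ Finset.range N, ∑ k ∈ Finset.range (m d), g (∑ e ∈ Finset.range d, m e + k) =
      ∑ t ∈ Finset.range (∑ e ∈ Finset.range N, m e), g t := by
  induction N with
  | zero => simp
  | succ N ih => rw [Finset.sum_range_succ, ih, Finset.sum_range_succ (fun e => m e),
      Finset.sum_range_add]

theorem sum_range_indicator_Ico (p q : ℤ) (N : ℕ) (hp : 0 ≤ p) (hq : q ≤ N) :
    ∑ t ∈ Finset.range N, (if p ≤ (t : ℤ) ∧ (t : ℤ) < q then (1 : ℤ) else 0) = max 0 (q - p) := by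
  rw [← Finset.sum_filter, Finset.sum_const, nsmul_one]
  have : (Finset.range N).filter (fun t : ℕ => p ≤ (t : ℤ) ∧ (t : ℤ) < q) =
      Finset.Ico p.toNat q.toNat := by
    ext t
    simp only [Finset.mem_filter, Finset.mem_range, Finset.mem_Ico]
    omega
  rw [this, Nat.card_Ico]
  omega

/-- Every point of `S_{D,m,M}` is a sum of `m d` antichains of `P_d` for each `d ∈ D` and at most
`M` unit vectors. -/
theorem exists_antichains_of_mem_latticeSD {n : ℕ} {D : Finset ℕ} {m : ℕ → ℕ} {M : ℕ}
    (hDn : ∀ d ∈ D, d < n) (hm : ∀ d, d ∉ D → m d = 0) {x : ℕ × ℕ → ℤ}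
    (hx : x ∈ latticeSD n D m M) :
    ∃ (A : ℕ → ℕ → Finset (ℕ × ℕ)) (z : ℕ × ℕ → ℤ),
      (∀ d k, k < m d → A d k ⊆ posetPd n d ∧ IsAntichain (· ≤ ·) (A d k : Set (ℕ × ℕ))) ∧
      (∀ α, 0 ≤ z α) ∧ (∀ α, α ∉ posetPD n D → z α = 0) ∧ ∑ α ∈ posetPD n D, z α ≤ M ∧
      x = fun α => ∑ d ∈ D, ∑ k ∈ Finset.range (m d), (if α ∈ A d k then 1 else 0) + z α := by
  classical
  obtain ⟨hx0, hxn, hxP⟩ := mem_latticeSD_iff.1 hx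
  have hPD : ∀ α ∈ posetPD n D, α ∈ posetP n := by
    intro α hα
    obtain ⟨d, -, hd⟩ := Finset.mem_biUnion.1 hα
    exact (Finset.mem_filter.1 hd).1
  have hP : ∀ α ∈ posetP n, α.2 < α.1 ∧ α.1 ≤ n := fun α hα => (Finset.mem_filter.1 hα).2.2
  obtain ⟨p, q, hqp, hlt, hq, hp, hsum⟩ := exists_potentials (ι := posetPD n D)
    (i := fun α => α.1.1) (j := fun α => α.1.2) (fun _ _ h => (Prod.le_def.1 h).1)
    (fun _ _ h => (Prod.le_def.1 h).2)
    (fun a => (hP _ (hPD _ a.2)).1) D m hm M (fun α => x α) (by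
      intro Q
      let Q' : Finset (ℕ × ℕ) := Q.map (Function.Embedding.subtype _)
      have hQ' : Q' ⊆ posetPD n D := by
        intro α hα
        obtain ⟨a, -, rfl⟩ := Finset.mem_map.1 hα
        exact a.2
      choose A hAQ hA hAc using fun d => exists_antichain_card_eq_finWidth (Q' ∩ posetPd n d)
      refine ⟨fun d => (A d).subtype _, fun d _ => ⟨fun a ha => ?_, ?_, fun a ha => ?_⟩, ?_⟩
      · have := Finset.mem_inter.1 (hAQ d (Finset.mem_subtype.1 ha))
        obtain ⟨b, hb, hba⟩ := Finset.mem_map.1 this.1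
        rwa [← Subtype.ext hba]
      · intro a ha b hb hab h
        exact hA d (Finset.mem_subtype.1 ha) (Finset.mem_subtype.1 hb)
          (fun h => hab (Subtype.ext h)) h
      · have := Finset.mem_inter.1 (hAQ d (Finset.mem_subtype.1 ha))
        exact (Finset.mem_filter.1 this.2).2.symm
      · have h1 := hxP Q' hQ'
        rw [Finset.sum_map] at h1
        refine h1.trans_eq ?_
        congr 1
        refine Finset.sum_congr rfl fun d _ => ?_
        rw [Finset.card_subtype, Finset.filter_true_of_mem, hAc]
        exact fun α hα => hQ' (Finset.mem_inter.1 (hAQ d hα)).1)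
  let s : ℕ → ℕ := fun k => ∑ d ∈ Finset.range k, m d
  have hs : Monotone s := fun a b hab =>
    Finset.sum_le_sum_of_subset (Finset.range_mono hab)
  have hs_succ : ∀ d, s (d + 1) = s d + m d := fun d => Finset.sum_range_succ _ _
  have hq' : ∀ a, q a ≤ s a.1.1 := fun a => by simpa [s] using hq a
  have hp' : ∀ a, (s a.1.2 : ℤ) ≤ p a := fun a => by simpa [s] using hp a
  let L : ℕ → Finset (posetPD n D) := fun t =>
    Finset.univ.filter fun a => p a ≤ (t : ℤ) ∧ (t : ℤ) < q a
  have hL : ∀ t a, a ∈ L t ↔ p a ≤ (t : ℤ) ∧ (t : ℤ) < q a := fun t a => by simp [L]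
  let A : ℕ → ℕ → Finset (ℕ × ℕ) := fun d k => (L (s d + k)).map (Function.Embedding.subtype _)
  have hA : ∀ d k, ∀ a : posetPD n D, a.1 ∈ A d k ↔ a ∈ L (s d + k) := by
    intro d k a
    simp [A]
  have hy : ∀ a : posetPD n D, ∑ d ∈ D, ∑ k ∈ Finset.range (m d),
      (if a.1 ∈ A d k then (1 : ℤ) else 0) = max 0 (q a - p a) := by
    intro a
    simp only [hA, hL]
    rw [← sum_range_indicator_Ico (p a) (q a) (s n)
      ((Nat.cast_nonneg _).trans (hp' a))
      ((hq' a).trans (Nat.cast_le.2 (hs (hP _ (hPD _ a.2)).2)))]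
    rw [← sum_range_sum_range_eq m (fun t => if p a ≤ (t : ℤ) ∧ (t : ℤ) < q a then (1 : ℤ) else 0)]
    apply Finset.sum_subset
    · exact fun d hd => Finset.mem_range.2 (hDn d hd)
    · intro d _ hd
      simp [hm d hd]
  have hy0 : ∀ α ∉ posetPD n D, ∑ d ∈ D, ∑ k ∈ Finset.range (m d),
      (if α ∈ A d k then (1 : ℤ) else 0) = 0 := by
    intro α hα
    refine Finset.sum_eq_zero fun d _ => Finset.sum_eq_zero fun k _ => if_neg fun h => hα ?_
    obtain ⟨a, -, rfl⟩ := Finset.mem_map.1 h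
    exact a.2
  refine ⟨A, fun α => x α - ∑ d ∈ D, ∑ k ∈ Finset.range (m d), (if α ∈ A d k then (1 : ℤ) else 0),
    fun d k hk => ⟨fun α hα => ?_, ?_⟩, fun α => ?_, fun α hα => ?_, ?_, ?_⟩
  · obtain ⟨a, ha, rfl⟩ := Finset.mem_map.1 hα
    obtain ⟨h1, h2⟩ := (hL _ _).1 ha
    have h3 : s a.1.2 ≤ s d + k := by exact_mod_cast (hp' a).trans h1
    have h4 : s d + k < s a.1.1 := by exact_mod_cast h2.trans_le (hq' a)
    refine Finset.mem_filter.2 ⟨hPD _ a.2, ?_, ?_⟩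
    · exact hs.reflect_lt (lt_of_le_of_lt (Nat.le_add_right _ _) h4)
    · refine Nat.lt_succ_iff.1 (hs.reflect_lt (lt_of_le_of_lt h3 ?_))
      have := hs_succ d
      simp only [Nat.succ_eq_add_one]
      omega
  · intro α hα β hβ hab hle
    obtain ⟨a, ha, rfl⟩ := Finset.mem_map.1 hα
    obtain ⟨b, hb, rfl⟩ := Finset.mem_map.1 hβ
    have hablt : a < b := lt_of_le_of_ne hle fun h => hab (by rw [h])
    have h1 := ((hL _ _).1 ha).2
    have h2 := ((hL _ _).1 hb).1
    have h3 := hlt a b hablt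
    omega
  · by_cases hα : α ∈ posetPD n D
    · have h1 := hy ⟨α, hα⟩
      have h2 := hqp ⟨α, hα⟩
      have h3 := hxn α
      dsimp only at h1 h2 ⊢
      rw [h1]
      exact sub_nonneg.2 (max_le h3 h2)
    · dsimp only
      rw [hy0 α hα, sub_zero]
      exact hxn α
  · dsimp only
    rw [hy0 α hα, hx0 α hα, sub_zero]
  · rw [← Finset.sum_coe_sort, Finset.sum_sub_distrib, Finset.sum_congr rfl fun a _ => hy a]
    have : ∑ a, (q a - p a) ≤ ∑ a, max 0 (q a - p a) :=
      Finset.sum_le_sum fun a _ => le_max_right _ _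
    linarith
  · funext α
    ring

theorem exists_split_of_sum_le {ι : Type*} (s : Finset ι) (z : ι → ℤ) (hz : ∀ a, 0 ≤ z a)
    (M M' : ℕ) (h : ∑ a ∈ s, z a ≤ M + M') :
    ∃ w : ι → ℤ, (∀ a, 0 ≤ w a) ∧ (∀ a, w a ≤ z a) ∧ ∑ a ∈ s, w a ≤ M ∧
      ∑ a ∈ s, (z a - w a) ≤ M' := by
  classical
  induction M generalizing M' with
  | zero => exact ⟨0, by simp, by simpa using hz, by simp, by simpa using h⟩
  | succ M ih =>
    obtain ⟨w, hw0, hwz, hw, hzw⟩ := ih (M' + 1) (by push_cast at h ⊢; linarith)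
    push_cast at hzw ⊢
    by_cases hM : ∑ a ∈ s, (z a - w a) ≤ M'
    · exact ⟨w, hw0, hwz, by linarith, hM⟩
    · obtain ⟨a, ha, hpos⟩ : ∃ a ∈ s, 0 < z a - w a := by
        by_contra! hc
        have := Finset.sum_nonpos hc
        have : (0 : ℤ) ≤ M' := Nat.cast_nonneg _
        linarith
      refine ⟨fun b => w b + if b = a then 1 else 0, fun b => ?_, fun b => ?_, ?_, ?_⟩
      · have := hw0 b
        dsimp only
        split_ifs <;> linarith
      · have := hwz b
        dsimp only
        split_ifs with hb
        · subst hb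
          linarith
        · linarith
      · rw [Finset.sum_add_distrib, Finset.sum_ite_eq' s a, if_pos ha]
        linarith
      · simp only [← sub_sub]
        rw [Finset.sum_sub_distrib, Finset.sum_ite_eq' s a, if_pos ha]
        linarith

/-- Minkowski sum property for integer points in the parabolic case:
`S_{𝐝,𝐦,M} + S_{𝐝,𝐦',M'} = S_{𝐝,𝐦+𝐦',M+M'}`. -/
theorem statement8 (n : ℕ) (hn : 2 ≤ n) (D : Finset ℕ) (hD : D.Nonempty)
    (hDn : ∀ d ∈ D, 1 ≤ d ∧ d < n) (m m' : ℕ → ℕ)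
    (hm : ∀ i, i ∉ D → m i = 0) (hm' : ∀ i, i ∉ D → m' i = 0) (M M' : ℕ) :
    latticeSD n D m M + latticeSD n D m' M' =
      latticeSD n D (fun d => m d + m' d) (M + M') := by
  refine Set.Subset.antisymm ?_ ?_
  · rintro _ ⟨x, hx, y, hy, rfl⟩
    obtain ⟨hx0, hxn, hxP⟩ := mem_latticeSD_iff.1 hx
    obtain ⟨hy0, hyn, hyP⟩ := mem_latticeSD_iff.1 hy
    refine mem_latticeSD_iff.2 ⟨fun α hα => ?_, fun α => add_nonneg (hxn α) (hyn α),
      fun P' hP' => ?_⟩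
    · simp [hx0 α hα, hy0 α hα]
    · have h1 := hxP P' hP'
      have h2 := hyP P' hP'
      simp only [Pi.add_apply, Finset.sum_add_distrib, Nat.cast_add, add_mul]
      linarith
  · intro x hx
    obtain ⟨A, z, hA, hz, hzD, hzM, rfl⟩ := exists_antichains_of_mem_latticeSD
      (fun d hd => (hDn d hd).2) (fun d hd => by simp [hm d hd, hm' d hd]) hx
    obtain ⟨w, hw0, hwz, hwM, hwM'⟩ := exists_split_of_sum_le (posetPD n D) z hz M M'
      (by exact_mod_cast hzM)
    refine ⟨_, mem_latticeSD_of_antichains (A := A) (z := w)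
      (fun d _ k hk => hA d k (Nat.lt_add_right _ hk)) hw0
      (fun α hα => le_antisymm ((hwz α).trans_eq (hzD α hα)) (hw0 α)) hwM,
      _, mem_latticeSD_of_antichains (A := fun d k => A d (m d + k)) (z := fun α => z α - w α)
      (fun d _ k hk => hA d _ (Nat.add_lt_add_left hk _)) (fun α => sub_nonneg.2 (hwz α))
      (fun α hα => ?_) hwM', ?_⟩
    · have := hwz α
      have := hw0 α
      have := hzD α hα
      omega
    · funext α
      simp only [Pi.add_apply, Finset.sum_range_add, Finset.sum_add_distrib]
      ring
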